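/- For every fixed rotor sequence and every vertex x ∈ V, the supremum maxcon(x) is attained: there exist an even initial configuration and a time T such that CON(x) = maxcon(x). -/

import Mathlib

open Finset

/-- Vertices: we work on `ℤ × ℤ`; the grid `V` consists of points with
`x₁ ≡ x₂ (mod 2)`. -/
abbrev Vtx : Type := ℤ × ℤ

/-- The four diagonal directions. -/
def DIRset : Finset Vtx := {(1,1), (1,-1), (-1,-1), (-1,1)}

/-- Membership in `V`: both coordinates have the same parity. -/
def inV (x : Vtx) : Prop := x.1 % 2 = x.2 % 2

/-- `H x t`: probability that a random-walk chip starting at `x` is at the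
origin after `t` steps. -/
noncomputable def H (x : Vtx) (t : ℕ) : ℝ :=
  if x.1 % 2 = (t : ℤ) % 2 ∧ x.2 % 2 = (t : ℤ) % 2 ∧ |x.1| ≤ (t : ℤ) ∧ |x.2| ≤ (t : ℤ) then
    (4 : ℝ) ^ (-(t : ℤ)) * (Nat.choose t (((t : ℤ) + x.1) / 2).toNat)
      * (Nat.choose t (((t : ℤ) + x.2) / 2).toNat)
  else 0

/-- `INF x A t := H (x+A) (t-1) - H x t`, for `t ≥ 1`. -/
noncomputable def INF (x A : Vtx) (t : ℕ) : ℝ := H (x + A) (t - 1) - H x t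

/-- A rotor sequence: a cyclic permutation of the four directions. -/
def IsRotorSequence (next : Vtx → Vtx) : Prop :=
  ∀ A ∈ DIRset, ({A, next A, next^[2] A, next^[3] A} : Finset Vtx) = DIRset

/-- One step of the Propp machine: a vertex holding `k` chips and rotor `d`
sends chip `i` (for `i = 0, …, k-1`) to `x + next^[i] d` and sets its rotor
to `next^[k] d`. -/
def proppStep (next : Vtx → Vtx) (st : (Vtx → ℕ) × (Vtx → Vtx)) :
    (Vtx → ℕ) × (Vtx → Vtx) :=
  (fun y => ∑ A ∈ DIRset,
      ((Finset.range (st.1 (y - A))).filter (fun i => next^[i] (st.2 (y - A)) = A)).card,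
   fun x => next^[st.1 x] (st.2 x))

/-- The Propp machine after `t` steps: chip counts and rotor directions. -/
def propp (next : Vtx → Vtx) (f0 : Vtx → ℕ) (arr0 : Vtx → Vtx) :
    ℕ → (Vtx → ℕ) × (Vtx → Vtx)
  | 0 => (f0, arr0)
  | t + 1 => proppStep next (propp next f0 arr0 t)

/-- An initial configuration is even if chips lie only on vertices `x ~ 0`. -/
def EvenConfig (f0 : Vtx → ℕ) : Prop :=
  ∀ x : Vtx, ¬(x.1 % 2 = 0 ∧ x.2 % 2 = 0) → f0 x = 0

/-- The linear machine: each vertex sends a quarter of its chips to each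
neighbor. -/
noncomputable def lin (f0 : Vtx → ℕ) : ℕ → Vtx → ℝ
  | 0 => fun x => (f0 x : ℝ)
  | t + 1 => fun x => (1/4) * ∑ A ∈ DIRset, lin f0 t (x + A)

/-- `sTime … x i`: the first time `u` with `i < ∑_{t=0}^{u} f(x,t)`, i.e. the
time at which `x` is occupied by its `i`-th chip. -/
noncomputable def sTime (next : Vtx → Vtx) (f0 : Vtx → ℕ) (arr0 : Vtx → Vtx)
    (x : Vtx) (i : ℕ) : ℕ :=
  sInf {u : ℕ | i < ∑ t ∈ Finset.range (u + 1), (propp next f0 arr0 t).1 x}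

/-- The contribution of vertex `x` for run-time `T`.  The chips with
`s_i(x) < T` are exactly those with `i < ∑_{t=0}^{T-1} f(x,t)`. -/
noncomputable def con (next : Vtx → Vtx) (f0 : Vtx → ℕ) (arr0 : Vtx → Vtx)
    (x : Vtx) (T : ℕ) : ℝ :=
  ∑ i ∈ Finset.range (∑ t ∈ Finset.range T, (propp next f0 arr0 t).1 x),
    INF x (next^[i] (arr0 x)) (T - sTime next f0 arr0 x i)

/-- `maxcon next x`: supremum of `con` over all even initial configurations
(with rotors pointing in directions of `DIRset`) and all run-times. -/
noncomputable def maxcon (next : Vtx → Vtx) (x : Vtx) : ℝ :=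
  sSup {c : ℝ | ∃ f0 arr0 T, EvenConfig f0 ∧ (∀ y : Vtx, arr0 y ∈ DIRset) ∧
    c = con next f0 arr0 x T}

/-- `mincon next x`: infimum of `con` over all even initial configurations
(with rotors pointing in directions of `DIRset`) and all run-times. -/
noncomputable def mincon (next : Vtx → Vtx) (x : Vtx) : ℝ :=
  sInf {c : ℝ | ∃ f0 arr0 T, EvenConfig f0 ∧ (∀ y : Vtx, arr0 y ∈ DIRset) ∧
    c = con next f0 arr0 x T}

lemma rot_mem {next : Vtx → Vtx} (hn : IsRotorSequence next) {d : Vtx} (hd : d ∈ DIRset) :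
    next d ∈ DIRset := by
  rw [← hn d hd]; simp

lemma rot_iter_mem {next : Vtx → Vtx} (hn : IsRotorSequence next) {d : Vtx} (hd : d ∈ DIRset)
    (k : ℕ) : next^[k] d ∈ DIRset := by
  induction k with
  | zero => exact hd
  | succ k ih => rw [Function.iterate_succ_apply']; exact rot_mem hn ih

lemma card_four (a b c e : Vtx) (h : ({a, b, c, e} : Finset Vtx).card = 4) :
    (a ≠ b ∧ a ≠ c ∧ a ≠ e) ∧ (b ≠ c ∧ b ≠ e) ∧ c ≠ e := by
  have h2 : (({a, b, c, e} : Multiset Vtx).toFinset).card = Multiset.card ({a, b, c, e} : Multiset Vtx) := by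
    simpa using h
  rw [Multiset.toFinset_card_eq_card_iff_nodup] at h2
  simp at h2
  tauto

lemma rot_distinct {next : Vtx → Vtx} (hn : IsRotorSequence next) {d : Vtx} (hd : d ∈ DIRset) :
    (d ≠ next d ∧ d ≠ next^[2] d ∧ d ≠ next^[3] d) ∧
    (next d ≠ next^[2] d ∧ next d ≠ next^[3] d) ∧ next^[2] d ≠ next^[3] d := by
  have h := hn d hd
  have hc : (DIRset).card = 4 := by decide
  rw [← h] at hc
  exact card_four _ _ _ _ hc

lemma rot_four {next : Vtx → Vtx} (hn : IsRotorSequence next) {d : Vtx} (hd : d ∈ DIRset) :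
    next^[4] d = d := by
  have h4 := rot_iter_mem hn hd 4
  rw [← hn d hd] at h4
  have hdis := rot_distinct hn (rot_mem hn hd)
  simp only [← Function.iterate_succ_apply] at hdis
  simp only [Finset.mem_insert, Finset.mem_singleton] at h4
  obtain ⟨⟨_, _, h1⟩, ⟨_, h2⟩, h3⟩ := hdis
  rcases h4 with h | h | h | h
  · exact h
  · exact absurd h.symm h1
  · exact absurd h.symm h2
  · exact absurd h.symm h3

lemma rot_four_mul {next : Vtx → Vtx} (hn : IsRotorSequence next) {d : Vtx} (hd : d ∈ DIRset)
    (k m : ℕ) : next^[k + 4 * m] d = next^[k] d := by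
  induction m with
  | zero => rfl
  | succ m ih =>
    rw [show k + 4 * (m + 1) = 4 + (k + 4 * m) by ring, Function.iterate_add_apply,
      rot_four hn (rot_iter_mem hn hd _), ih]

lemma rot_reach {next : Vtx → Vtx} (hn : IsRotorSequence next) {d e : Vtx} (hd : d ∈ DIRset)
    (he : e ∈ DIRset) : ∃ k, next^[k] d = e := by
  rw [← hn d hd] at he
  simp only [Finset.mem_insert, Finset.mem_singleton] at he
  rcases he with h | h | h | h
  · exact ⟨0, h.symm⟩
  · exact ⟨1, h.symm⟩
  · exact ⟨2, h.symm⟩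
  · exact ⟨3, h.symm⟩

lemma rot_sum {next : Vtx → Vtx} (hn : IsRotorSequence next) {d : Vtx} (hd : d ∈ DIRset)
    {M : Type*} [AddCommMonoid M] (F : Vtx → M) :
    F d + (F (next d) + (F (next^[2] d) + F (next^[3] d))) = ∑ A ∈ DIRset, F A := by
  obtain ⟨⟨h1, h2, h3⟩, ⟨h4, h5⟩, h6⟩ := rot_distinct hn hd
  rw [← hn d hd, Finset.sum_insert (by simp only [Finset.mem_insert, Finset.mem_singleton]; tauto),
    Finset.sum_insert (by simp only [Finset.mem_insert, Finset.mem_singleton]; tauto),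
    Finset.sum_insert (by simp only [Finset.mem_singleton]; tauto), Finset.sum_singleton]

lemma card_add {next : Vtx → Vtx} (hn : IsRotorSequence next) {d A : Vtx} (hd : d ∈ DIRset)
    (hA : A ∈ DIRset) (k m : ℕ) :
    ((Finset.range (k + 4 * m)).filter (fun i => next^[i] d = A)).card =
      ((Finset.range k).filter (fun i => next^[i] d = A)).card + m := by
  simp only [Finset.card_filter]
  induction m with
  | zero => simp
  | succ m ih =>
    rw [show k + 4 * (m + 1) = (k + 4 * m) + 1 + 1 + 1 + 1 by ring, Finset.sum_range_succ,
      Finset.sum_range_succ, Finset.sum_range_succ, Finset.sum_range_succ, ih]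
    have h := rot_sum hn (rot_iter_mem hn hd (k + 4 * m)) (fun B => if B = A then 1 else 0)
    rw [Finset.sum_ite_eq' DIRset A] at h
    simp only [hA, if_true, ← Function.iterate_add_apply] at h
    rw [← Function.iterate_succ_apply' next] at h
    rw [show 2 + (k + 4 * m) = k + 4 * m + 1 + 1 by ring,
      show 3 + (k + 4 * m) = k + 4 * m + 1 + 1 + 1 by ring] at h
    simp only [Nat.succ_eq_add_one, Function.iterate_succ_apply'] at h ⊢
    omega

lemma arr_mem {next : Vtx → Vtx} (hn : IsRotorSequence next) (f0 : Vtx → ℕ) {arr0 : Vtx → Vtx}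
    (ha : ∀ y, arr0 y ∈ DIRset) (t : ℕ) (y : Vtx) : (propp next f0 arr0 t).2 y ∈ DIRset := by
  induction t generalizing y with
  | zero => exact ha y
  | succ t ih => exact rot_iter_mem hn (ih y) _

/-- Adjacency operator. -/
def Lop (g : Vtx → ℕ) : Vtx → ℕ := fun y => ∑ A ∈ DIRset, g (y - A)

lemma propp_add {next : Vtx → Vtx} (hn : IsRotorSequence next) (f0 g : Vtx → ℕ)
    {arr0 : Vtx → Vtx} (ha : ∀ y, arr0 y ∈ DIRset) (s t : ℕ) :
    propp next (fun y => f0 y + 4 ^ (t + s) * g y) arr0 t =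
      (fun y => (propp next f0 arr0 t).1 y + 4 ^ s * (Lop^[t] g) y,
        (propp next f0 arr0 t).2) := by
  induction t generalizing s with
  | zero => simp [propp]
  | succ t ih =>
    have h := ih (s + 1)
    rw [show t + (s + 1) = t + 1 + s by ring] at h
    simp only [propp]
    rw [h]
    unfold proppStep
    simp only
    refine Prod.ext ?_ ?_
    · funext y
      simp only [Function.iterate_succ_apply', Lop]
      rw [Finset.mul_sum, ← Finset.sum_add_distrib]
      refine Finset.sum_congr rfl fun A hA => ?_
      rw [pow_succ', mul_assoc, card_add hn (arr_mem hn f0 ha t _) hA]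
    · funext y
      simp only
      rw [pow_succ', mul_assoc, rot_four_mul hn (arr_mem hn f0 ha t _)]

lemma DIR_sum {M : Type*} [AddCommMonoid M] (F : Vtx → M) :
    ∑ A ∈ DIRset, F A = F (1,1) + (F (1,-1) + (F (-1,-1) + F (-1,1))) := by
  unfold DIRset
  rw [Finset.sum_insert (by decide), Finset.sum_insert (by decide), Finset.sum_insert (by decide),
    Finset.sum_singleton]

lemma Lop_zero (g : Vtx → ℕ) (a b : ℤ) (hg : ∀ y : Vtx, (y.1 < a ∨ y.2 < b) → g y = 0) (t : ℕ) :
    ∀ y : Vtx, (y.1 < a - t ∨ y.2 < b - t) → (Lop^[t] g) y = 0 := by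
  induction t with
  | zero => simpa using hg
  | succ t ih =>
    intro y hy
    rw [Function.iterate_succ_apply']
    change ∑ A ∈ DIRset, (Lop^[t] g) (y - A) = 0
    push_cast at hy
    rw [DIR_sum, ih (y - (1, 1)), ih (y - (1, -1)), ih (y - (-1, -1)), ih (y - (-1, 1))]
    all_goals first | rfl | (simp only [Prod.fst_sub, Prod.snd_sub]; omega)

lemma Lop_corner (g : Vtx → ℕ) (a b : ℤ) (hg : ∀ y : Vtx, (y.1 < a ∨ y.2 < b) → g y = 0)
    (t : ℕ) : (Lop^[t] g) (a - t, b - t) = g (a, b) := by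
  induction t with
  | zero => simp
  | succ t ih =>
    rw [Function.iterate_succ_apply']
    change ∑ A ∈ DIRset, (Lop^[t] g) _ = _
    push_cast
    have hz := Lop_zero g a b hg t
    rw [DIR_sum, hz ((a - (t + 1), b - (t + 1)) - (1, 1)), hz ((a - (t + 1), b - (t + 1)) - (1, -1)),
      hz ((a - (t + 1), b - (t + 1)) - (-1, 1)), ← ih]
    · simp only [Prod.mk_sub_mk, zero_add, add_zero]
      ring_nf
    all_goals simp only [Prod.mk_sub_mk]; omega

lemma even_prop {next : Vtx → Vtx} {f0 : Vtx → ℕ} (hf : EvenConfig f0) (arr0 : Vtx → Vtx)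
    (t : ℕ) (y : Vtx) (hy : ¬ (y.1 % 2 = (t : ℤ) % 2 ∧ y.2 % 2 = (t : ℤ) % 2)) :
    (propp next f0 arr0 t).1 y = 0 := by
  induction t generalizing y with
  | zero => exact hf y (by simpa using hy)
  | succ t ih =>
    simp only [propp, proppStep]
    refine Finset.sum_eq_zero fun A hA => ?_
    rw [ih]
    · simp
    · unfold DIRset at hA
      simp only [Finset.mem_insert, Finset.mem_singleton] at hA
      push_cast at hy
      rcases hA with h | h | h | h <;> subst h <;> simp only [Prod.fst_sub, Prod.snd_sub] <;> omega

/-- Valid rotor histories. -/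
def Valid (x : Vtx) (r : ℕ → Vtx) : Prop :=
  (∀ t, r t ∈ DIRset) ∧ ∀ t : ℕ, x.1 % 2 ≠ (t : ℤ) % 2 → r (t + 1) = r t

lemma valid_propp {next : Vtx → Vtx} (hn : IsRotorSequence next) {f0 : Vtx → ℕ}
    (hf : EvenConfig f0) {arr0 : Vtx → Vtx} (ha : ∀ y, arr0 y ∈ DIRset) (x : Vtx) :
    Valid x (fun t => (propp next f0 arr0 t).2 x) := by
  refine ⟨fun t => arr_mem hn f0 ha t x, fun t ht => ?_⟩
  change next^[(propp next f0 arr0 t).1 x] _ = _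
  rw [even_prop hf arr0 t x (fun h => ht h.1)]
  rfl

lemma realize {next : Vtx → Vtx} (hn : IsRotorSequence next) {x : Vtx} (hx : inV x)
    {r : ℕ → Vtx} (hr : Valid x r) (T : ℕ) :
    ∃ f0 : Vtx → ℕ, EvenConfig f0 ∧ ∀ t ≤ T, (propp next f0 (fun _ => r 0) t).2 x = r t := by
  have ha : ∀ y : Vtx, (fun _ => r 0) y ∈ DIRset := fun _ => hr.1 0
  induction T with
  | zero => exact ⟨fun _ => 0, fun _ _ => rfl, fun t ht => by
      obtain rfl : t = 0 := by omega
      rfl⟩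
  | succ T ih =>
    obtain ⟨f0, hf, h⟩ := ih
    by_cases hp : x.1 % 2 = (T : ℤ) % 2
    · obtain ⟨c, hc⟩ := rot_reach hn (arr_mem hn f0 ha (T + 1) x) (hr.1 (T + 1))
      set g : Vtx → ℕ := fun y => if y = (x.1 + T, x.2 + T) then c else 0 with hg
      have hg0 : ∀ y : Vtx, (y.1 < x.1 + T ∨ y.2 < x.2 + T) → g y = 0 := by
        intro y hy
        simp only [hg]
        rw [if_neg]
        rintro rfl
        simp at hy
      refine ⟨fun y => f0 y + 4 ^ T * g y, ?_, ?_⟩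
      · intro y hy
        simp only
        rw [hf y hy]
        simp only [hg]
        rw [if_neg]
        · rfl
        · rintro rfl
          unfold inV at hx
          apply hy
          simp only
          omega
      · intro t ht
        rcases Nat.lt_or_ge T t with h1 | h1
        · obtain rfl : t = T + 1 := by omega
          have hh := propp_add hn f0 g ha 0 T
          rw [add_zero] at hh
          simp only [propp]
          rw [hh]
          simp only [proppStep]
          have hL := Lop_corner g _ _ hg0 T
          simp only [add_sub_cancel_right] at hL
          rw [show (x.1, x.2) = x from rfl] at hL
          rw [hL, pow_zero, one_mul, add_comm, Function.iterate_add_apply]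
          have : g (x.1 + T, x.2 + T) = c := by simp [hg]
          rw [this]
          exact hc
        · have hh := propp_add hn f0 g ha (T - t) t
          rw [Nat.add_sub_cancel' h1] at hh
          rw [hh]
          exact h t h1
    · refine ⟨f0, hf, fun t ht => ?_⟩
      rcases Nat.lt_or_ge T t with h1 | h1
      · obtain rfl : t = T + 1 := by omega
        refine ((valid_propp hn hf ha x).2 T hp).trans ?_
        rw [hr.2 T hp]
        exact h T le_rfl
      · exact h t h1

/-- One-dimensional kernel. -/
noncomputable def hh (z : ℤ) (t : ℕ) : ℝ :=
  if z % 2 = (t : ℤ) % 2 ∧ |z| ≤ (t : ℤ) then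
    (Nat.choose t (((t : ℤ) + z) / 2).toNat : ℝ) / 2 ^ t else 0

lemma H_eq (x : Vtx) (t : ℕ) : H x t = hh x.1 t * hh x.2 t := by
  unfold H hh
  split_ifs with h1 h2 h3 h3 h2 h3
  · rw [zpow_neg, zpow_natCast, show (4 : ℝ) = 2 * 2 by norm_num, mul_pow]
    field_simp
  all_goals first | tauto | simp

lemma hh_nonneg (z : ℤ) (t : ℕ) : 0 ≤ hh z t := by
  unfold hh; split_ifs <;> positivity

lemma hh_form (k t : ℕ) : hh (2 * k - t) t = (Nat.choose t k : ℝ) / 2 ^ t := by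
  unfold hh
  split_ifs with h
  · congr 3; omega
  · have : t < k := by
      by_contra hk
      apply h
      refine ⟨by omega, ?_⟩
      rw [abs_le]; omega
    rw [Nat.choose_eq_zero_of_lt this]; simp

lemma hh_nonform (z : ℤ) (t : ℕ) (h : ∀ k : ℕ, z ≠ 2 * k - t) : hh z t = 0 := by
  unfold hh
  rw [if_neg]
  rintro ⟨h1, h2⟩
  rw [abs_le] at h2
  exact h (((t : ℤ) + z) / 2).toNat (by omega)

lemma hh_plus (z : ℤ) (s : ℕ) : hh (z + 1) s * (s + 1) = hh z (s + 1) * (s + 1 - z) := by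
  by_cases h : ∃ k : ℕ, z = 2 * k - ((s + 1 : ℕ) : ℤ)
  · obtain ⟨k, rfl⟩ := h
    rw [hh_form, show 2 * (k : ℤ) - ((s + 1 : ℕ) : ℤ) + 1 = 2 * k - s by push_cast; ring, hh_form]
    push_cast
    rw [pow_succ]
    have := Nat.choose_mul_succ_eq s k
    rcases Nat.lt_or_ge (s + 1) k with hk | hk
    · rw [Nat.choose_eq_zero_of_lt hk, Nat.choose_eq_zero_of_lt (by omega)]; simp
    · have h2 : (s.choose k : ℝ) * (s + 1) = (s + 1).choose k * (s + 1 - k) := by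
        have h3 : ((s.choose k * (s + 1) : ℕ) : ℝ) = (((s + 1).choose k * (s + 1 - k) : ℕ) : ℝ) := by
          rw [this]
        rw [Nat.cast_mul, Nat.cast_mul, Nat.cast_sub hk] at h3
        exact_mod_cast h3
      field_simp
      linear_combination 2 * h2
  · push Not at h
    rw [hh_nonform z _ h, hh_nonform (z + 1) s]
    · simp
    · intro k hk
      apply h k; push_cast; omega

lemma hh_minus (z : ℤ) (s : ℕ) : hh (z - 1) s * (s + 1) = hh z (s + 1) * (s + 1 + z) := by
  by_cases h : ∃ k : ℕ, z = 2 * k - ((s + 1 : ℕ) : ℤ)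
  · obtain ⟨k, rfl⟩ := h
    rw [hh_form]
    rcases k with _ | k
    · rw [hh_nonform _ s]
      · push_cast; ring
      · intro k; push_cast; omega
    · rw [show 2 * ((k + 1 : ℕ) : ℤ) - ((s + 1 : ℕ) : ℤ) - 1 = 2 * k - s by push_cast; ring, hh_form]
      push_cast
      rw [pow_succ]
      have h2 : ((s : ℝ) + 1) * s.choose k = (s + 1).choose (k + 1) * (k + 1) := by
        exact_mod_cast Nat.add_one_mul_choose_eq s k
      field_simp
      linear_combination 2 * h2
  · push Not at h
    rw [hh_nonform z _ h, hh_nonform (z - 1) s]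
    · simp
    · intro k hk
      apply h (k + 1); push_cast; omega

lemma hh_two (z : ℤ) (s : ℕ) :
    hh z s * ((s + 1) * (s + 2)) = hh z (s + 2) * ((s + 2) ^ 2 - z ^ 2) := by
  have h1 := hh_plus z (s + 1)
  have h2 := hh_minus (z + 1) s
  rw [add_sub_cancel_right] at h2
  push_cast at h1 h2
  rw [show s + 1 + 1 = s + 2 from rfl] at h1
  linear_combination (s + 2 : ℝ) * h2 + ((s : ℝ) + 2 + z) * h1

lemma INF_eq (x A : Vtx) (hA : A ∈ DIRset) (s : ℕ) :
    INF x A (s + 1) = H x (s + 1) *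
      (-(A.1 * x.1 + A.2 * x.2) / (s + 1) + A.1 * A.2 * (x.1 * x.2) / (s + 1) ^ 2) := by
  have hs : (s : ℝ) + 1 ≠ 0 := by positivity
  have key : ∀ (e z : ℤ), e = 1 ∨ e = -1 →
      hh (z + e) s = hh z (s + 1) * (s + 1 - e * z) / (s + 1) := by
    rintro e z (rfl | rfl)
    · rw [eq_div_iff hs, hh_plus]; push_cast; ring
    · rw [eq_div_iff hs, ← sub_eq_add_neg, hh_minus]; push_cast; ring
  have hA' : (A.1 = 1 ∨ A.1 = -1) ∧ (A.2 = 1 ∨ A.2 = -1) := by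
    unfold DIRset at hA
    simp only [Finset.mem_insert, Finset.mem_singleton] at hA
    rcases hA with h | h | h | h <;> subst h <;> simp
  unfold INF
  rw [Nat.add_sub_cancel, H_eq, H_eq, Prod.fst_add, Prod.snd_add, key _ _ hA'.1, key _ _ hA'.2]
  field_simp
  ring

/-- Weighted sum along the rotor cycle. -/
noncomputable def wsum (next : Vtx → Vtx) (F : Vtx → ℝ) (d : Vtx) : ℝ :=
  (1 / 4) * (F (next d) + 2 * F (next^[2] d) + 3 * F (next^[3] d))

/-- Potential. -/
noncomputable def Phi (next : Vtx → Vtx) (x d : Vtx) (u : ℕ) : ℝ :=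
  wsum next (fun A => INF x A u) d

lemma INF_sum (x : Vtx) (s : ℕ) : ∑ A ∈ DIRset, INF x A (s + 1) = 0 := by
  rw [Finset.sum_congr rfl (fun A hA => INF_eq x A hA s), DIR_sum]
  push_cast
  ring

lemma Phi_next {next : Vtx → Vtx} (hn : IsRotorSequence next) (x : Vtx) {d : Vtx}
    (hd : d ∈ DIRset) {u : ℕ} (hu : 0 < u) :
    Phi next x (next d) u - Phi next x d u = INF x d u := by
  obtain ⟨s, rfl⟩ : ∃ s, u = s + 1 := ⟨u - 1, by omega⟩
  have h0 := rot_sum hn hd (fun A => INF x A (s + 1))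
  rw [INF_sum] at h0
  unfold Phi wsum
  have h4 := rot_four hn hd
  simp only [← Function.iterate_succ_apply]
  simp only [Nat.succ_eq_add_one, show 2 + 1 = 3 from rfl, show 3 + 1 = 4 from rfl, h4]
  rw [show next (next d) = next^[2] d from rfl]
  linarith

/-- Linear coefficient. -/
noncomputable def al (next : Vtx → Vtx) (x d : Vtx) : ℝ := wsum next (fun A => (A.1 * x.1 + A.2 * x.2 : ℝ)) d
/-- Quadratic coefficient. -/
noncomputable def be (next : Vtx → Vtx) (x d : Vtx) : ℝ := wsum next (fun A => (A.1 * A.2 * (x.1 * x.2) : ℝ)) d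

lemma Phi_eq {next : Vtx → Vtx} (hn : IsRotorSequence next) (x : Vtx) {d : Vtx}
    (hd : d ∈ DIRset) (s : ℕ) :
    Phi next x d (s + 1) = H x (s + 1) *
      (-(al next x d) / (s + 1) + be next x d / (s + 1) ^ 2) := by
  unfold Phi al be wsum
  beta_reduce
  rw [INF_eq _ _ (rot_mem hn hd), INF_eq _ _ (rot_iter_mem hn hd 2),
    INF_eq _ _ (rot_iter_mem hn hd 3)]
  ring

lemma H_nonneg (x : Vtx) (t : ℕ) : 0 ≤ H x t := by
  rw [H_eq]; exact mul_nonneg (hh_nonneg _ _) (hh_nonneg _ _)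

/-- The value of a rotor history. -/
noncomputable def rval (next : Vtx → Vtx) (x : Vtx) (r : ℕ → Vtx) (T : ℕ) : ℝ :=
  ∑ t ∈ Finset.range T, (Phi next x (r (t + 1)) (T - t) - Phi next x (r t) (T - t))

lemma arr_iter (next : Vtx → Vtx) (f0 : Vtx → ℕ) (arr0 : Vtx → Vtx) (x : Vtx) (t : ℕ) :
    (propp next f0 arr0 t).2 x =
      next^[∑ s ∈ Finset.range t, (propp next f0 arr0 s).1 x] (arr0 x) := by
  induction t with
  | zero => rfl
  | succ t ih =>
    rw [Finset.sum_range_succ, add_comm (∑ s ∈ Finset.range t, _), Function.iterate_add_apply, ← ih]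
    rfl

lemma con_eq {next : Vtx → Vtx} (hn : IsRotorSequence next) (f0 : Vtx → ℕ)
    {arr0 : Vtx → Vtx} (ha : ∀ y, arr0 y ∈ DIRset) (x : Vtx) (T : ℕ) :
    con next f0 arr0 x T = rval next x (fun t => (propp next f0 arr0 t).2 x) T := by
  unfold con rval
  have key : ∀ S ≤ T, ∑ i ∈ Finset.range (∑ t ∈ Finset.range S, (propp next f0 arr0 t).1 x),
      INF x (next^[i] (arr0 x)) (T - sTime next f0 arr0 x i) =
      ∑ t ∈ Finset.range S, (Phi next x ((propp next f0 arr0 (t + 1)).2 x) (T - t)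
        - Phi next x ((propp next f0 arr0 t).2 x) (T - t)) := by
    intro S hS
    induction S with
    | zero => simp
    | succ S ih =>
      rw [Finset.sum_range_succ _ S, Finset.sum_range_add, ih (by omega), Finset.sum_range_succ]
      congr 1
      have hs : ∀ j ∈ Finset.range ((propp next f0 arr0 S).1 x),
          INF x (next^[∑ t ∈ Finset.range S, (propp next f0 arr0 t).1 x + j] (arr0 x))
            (T - sTime next f0 arr0 x (∑ t ∈ Finset.range S, (propp next f0 arr0 t).1 x + j)) =
          Phi next x (next^[j + 1] ((propp next f0 arr0 S).2 x)) (T - S)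
          - Phi next x (next^[j] ((propp next f0 arr0 S).2 x)) (T - S) := by
        intro j hj
        rw [Finset.mem_range] at hj
        have hst : sTime next f0 arr0 x (∑ t ∈ Finset.range S, (propp next f0 arr0 t).1 x + j)
            = S := by
          unfold sTime
          apply IsLeast.csInf_eq
          constructor
          · simp only [Set.mem_ofPred_eq]
            rw [Finset.sum_range_succ]; omega
          · intro u hu
            simp only [Set.mem_ofPred_eq] at hu
            by_contra hlt
            have : ∑ t ∈ Finset.range (u + 1), (propp next f0 arr0 t).1 x ≤
                ∑ t ∈ Finset.range S, (propp next f0 arr0 t).1 x :=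
              Finset.sum_le_sum_of_subset (Finset.range_subset_range.2 (by omega))
            omega
        rw [hst, add_comm, Function.iterate_add_apply, ← arr_iter, Function.iterate_succ_apply',
          Phi_next hn x (rot_iter_mem hn (arr_mem hn f0 ha S x) j) (by omega)]
      rw [Finset.sum_congr rfl hs,
        Finset.sum_range_sub (fun j => Phi next x (next^[j] ((propp next f0 arr0 S).2 x)) (T - S))]
      rfl
  exact key T le_rfl

lemma quartic_event (a p q r w : ℝ) (ha : 0 < a) :
    ∀ᶠ s : ℕ in Filter.atTop,
      0 ≤ a * (s : ℝ) ^ 4 + p * (s : ℝ) ^ 3 + q * (s : ℝ) ^ 2 + r * s + w := by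
  filter_upwards [Filter.eventually_ge_atTop 1,
    Filter.eventually_ge_atTop ⌈(|p| + |q| + |r| + |w|) / a⌉₊] with n h1 h2
  have h1' : (1 : ℝ) ≤ n := by exact_mod_cast h1
  have h2' := Nat.ceil_le.1 h2
  rw [div_le_iff₀ ha] at h2'
  generalize (n : ℝ) = s at h1' h2'
  have hs0 : 0 ≤ s := by linarith
  have s3 : 0 ≤ s ^ 3 := by positivity
  have e0 : 1 ≤ s ^ 3 := one_le_pow₀ h1'
  have e1 : s ≤ s ^ 3 := by simpa using pow_le_pow_right₀ h1' (show 1 ≤ 3 by norm_num)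
  have e2 : s ^ 2 ≤ s ^ 3 := pow_le_pow_right₀ h1' (show 2 ≤ 3 by norm_num)
  have m := mul_le_mul_of_nonneg_right h2' s3
  have f3 : -|p| * s ^ 3 ≤ p * s ^ 3 := mul_le_mul_of_nonneg_right (neg_abs_le p) s3
  have f2 : -|q| * s ^ 2 ≤ q * s ^ 2 := mul_le_mul_of_nonneg_right (neg_abs_le q) (by positivity)
  have f1 : -|r| * s ≤ r * s := mul_le_mul_of_nonneg_right (neg_abs_le r) hs0
  have f0 := neg_abs_le w
  have g2 := mul_le_mul_of_nonneg_left e2 (abs_nonneg q)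
  have g1 := mul_le_mul_of_nonneg_left e1 (abs_nonneg r)
  have g0 := mul_le_mul_of_nonneg_left e0 (abs_nonneg w)
  nlinarith

lemma poly_event (a b c d : ℝ) (h : 0 < a ∨ (a = 0 ∧ b ≤ 0)) :
    ∀ᶠ s : ℕ in Filter.atTop,
      -a * (s + 2) + b ≤ 0 ∧
      (-a * s + b) * (((s : ℝ) + 2) ^ 2 - c) * (((s : ℝ) + 2) ^ 2 - d) ≤
        (-a * (s + 2) + b) * (s + 1) ^ 2 * s ^ 2 := by
  rcases h with ha | ⟨rfl, hb⟩
  · filter_upwards [quartic_event (4 * a)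
      (2 * (b - 2 * a) - a - 8 * b + a * (16 + (4 - c) + (4 - d)))
      ((b - 2 * a) - b * (16 + (4 - c) + (4 - d)) + 4 * a * ((4 - c) + (4 - d)))
      (-4 * b * ((4 - c) + (4 - d)) + a * (4 - c) * (4 - d)) (-b * (4 - c) * (4 - d))
      (by linarith), Filter.eventually_ge_atTop ⌈b / a⌉₊] with n h1 h2
    have h2' := Nat.ceil_le.1 h2
    rw [div_le_iff₀ ha] at h2'
    constructor
    · linarith
    · linarith
  · filter_upwards [quartic_event 6 (23 - c - d) (32 - 4 * c - 4 * d) ((4 - c) * (4 - d)) 0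
      (by norm_num), Filter.eventually_ge_atTop 1] with n h1 h2
    have hn : (0 : ℝ) < n := by exact_mod_cast h2
    refine ⟨by simpa using hb, ?_⟩
    have h3 : 0 ≤ 6 * (n : ℝ) ^ 3 + (23 - c - d) * (n : ℝ) ^ 2 + (32 - 4 * c - 4 * d) * n
        + (4 - c) * (4 - d) := by
      by_contra hlt
      push Not at hlt
      have := mul_neg_of_pos_of_neg hn hlt
      linarith
    have := mul_nonneg (neg_nonneg.2 hb) h3
    linarith

lemma good_rotor {next : Vtx → Vtx} (hn : IsRotorSequence next) (x : Vtx) :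
    ∃ e ∈ DIRset, ∃ U : ℕ, ∀ s ≥ U, ∀ d ∈ DIRset,
      Phi next x e (s + 2) ≤ Phi next x d (s + 2) ∧
      Phi next x d (s + 2) - Phi next x d s ≤ Phi next x e (s + 2) - Phi next x e s := by
  obtain ⟨e, he, hmax⟩ := Finset.exists_max_image DIRset
    (fun d => toLex (al next x d, -be next x d)) ⟨(1,1), by decide⟩
  refine ⟨e, he, ?_⟩
  have hev : ∀ d ∈ DIRset, ∀ᶠ s : ℕ in Filter.atTop,
      Phi next x e (s + 2) ≤ Phi next x d (s + 2) ∧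
      Phi next x d (s + 2) - Phi next x d s ≤ Phi next x e (s + 2) - Phi next x e s := by
    intro d hd
    have hab : 0 < al next x e - al next x d ∨
        (al next x e - al next x d = 0 ∧ be next x e - be next x d ≤ 0) := by
      have := hmax d hd
      rw [Prod.Lex.toLex_le_toLex] at this
      rcases this with h | ⟨h, h'⟩
      · left; linarith
      · right; constructor <;> linarith
    filter_upwards [poly_event _ _ (x.1 ^ 2 : ℝ) (x.2 ^ 2 : ℝ) hab, Filter.eventually_ge_atTop 1]
      with s hs h1
    obtain ⟨hs1, hs2⟩ := hs
    have hP2 : ∀ d ∈ DIRset, Phi next x d (s + 2) = H x (s + 2) / (s + 2) ^ 2 *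
        (-(al next x d) * (s + 2) + be next x d) := by
      intro d hd
      rw [Phi_eq hn x hd (s + 1)]
      push_cast
      rw [show (s : ℝ) + 1 + 1 = s + 2 by ring, show s + 1 + 1 = s + 2 from rfl]
      field_simp
    have hs0 : (0 : ℝ) < s := by exact_mod_cast h1
    have hP0 : ∀ d ∈ DIRset, Phi next x d s = H x (s + 2) / ((s + 2) ^ 2 * (s + 1) ^ 2 * s ^ 2) *
        ((-(al next x d) * s + be next x d) * (((s : ℝ) + 2) ^ 2 - x.1 ^ 2)
          * (((s : ℝ) + 2) ^ 2 - x.2 ^ 2)) := by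
      intro d hd
      obtain ⟨v, rfl⟩ : ∃ v, s = v + 1 := ⟨s - 1, by omega⟩
      have e1 := hh_two x.1 (v + 1)
      have e2 := hh_two x.2 (v + 1)
      rw [Phi_eq hn x hd v, H_eq, H_eq]
      push_cast at *
      have e3 := congrArg₂ (· * ·) e1 e2
      beta_reduce at e3
      field_simp
      linear_combination (-(al next x d) * (v + 1) + be next x d) * e3
    have hHn := H_nonneg x (s + 2)
    have n2 : 0 ≤ H x (s + 2) / (s + 2) ^ 2 := by positivity
    have n0 : 0 ≤ H x (s + 2) / (((s : ℝ) + 2) ^ 2 * (s + 1) ^ 2 * s ^ 2) := by positivity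
    rw [hP2 d hd, hP2 e he, hP0 d hd, hP0 e he]
    constructor
    · apply mul_le_mul_of_nonneg_left _ n2
      linarith
    · have hrw : H x (s + 2) / (s + 2) ^ 2 =
          H x (s + 2) / (((s : ℝ) + 2) ^ 2 * (s + 1) ^ 2 * s ^ 2) * ((s + 1) ^ 2 * s ^ 2) := by
        field_simp
      rw [hrw]
      have := mul_le_mul_of_nonneg_left hs2 n0
      linarith
  have hall := (Filter.eventually_all_finset DIRset).2 hev
  exact Filter.eventually_atTop.1 hall

lemma reduce (next : Vtx → Vtx) (x e : Vtx) (he : e ∈ DIRset) (U : ℕ)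
    (hU : ∀ s ≥ U, ∀ d ∈ DIRset,
      Phi next x e (s + 2) ≤ Phi next x d (s + 2) ∧
      Phi next x d (s + 2) - Phi next x d s ≤ Phi next x e (s + 2) - Phi next x e s)
    {r : ℕ → Vtx} (hr : Valid x r) (T : ℕ) (hT : U ≤ T) :
    ∃ r', Valid x r' ∧ rval next x r (T + 4) ≤ rval next x r' (T + 2) := by
  refine ⟨fun t => if t = 0 then e else if t = 1 then (if x.1 % 2 = 0 then r 3 else e)
    else r (t + 2), ⟨?_, ?_⟩, ?_⟩
  · intro t
    simp only
    split_ifs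
    · exact he
    · exact hr.1 3
    · exact he
    · exact hr.1 _
  · intro t ht
    rcases t with _ | _ | t
    · simp at ht; simp [ht]
    · have h3 := hr.2 3 (by push_cast at ht ⊢; omega)
      have : x.1 % 2 = 0 := by push_cast at ht; omega
      simp [this, h3]
    · have := hr.2 (t + 2 + 2) (by push_cast at ht ⊢; omega)
      simp
      exact this
  · unfold rval
    rw [Finset.sum_range_succ', Finset.sum_range_succ', Finset.sum_range_succ',
      Finset.sum_range_succ', Finset.sum_range_succ', Finset.sum_range_succ' _ T]
    have hrest : ∀ t, T + 4 - (t + 1 + 1 + 1 + 1) = T + 2 - (t + 1 + 1) := by intro t; omega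
    simp only [hrest]
    simp
    have k1 : ∀ t, t + 1 + 1 + 1 + 2 = t + 1 + 1 + 1 + 1 + 1 := fun _ => rfl
    have k2 : ∀ t, t + 1 + 1 + 2 = t + 1 + 1 + 1 + 1 := fun _ => rfl
    simp only [k1, k2]
    by_cases hp : 2 ∣ x.1
    · have h1 : r 2 = r 1 := hr.2 1 (by push_cast; omega)
      have h3 : r 4 = r 3 := hr.2 3 (by push_cast; omega)
      rw [if_pos hp, h1, h3]
      have a1 := (hU (T + 2) (by omega) (r 1) (hr.1 1)).2
      have a2 := (hU (T + 2) (by omega) (r 0) (hr.1 0)).1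
      rw [show T + 2 + 2 = T + 4 from rfl] at a1 a2
      linarith
    · have h1 : r 1 = r 0 := hr.2 0 (by push_cast; omega)
      have h3 : r 3 = r 2 := hr.2 2 (by push_cast; omega)
      rw [if_neg hp, h1, h3]
      have a1 := (hU (T + 1) (by omega) (r 2) (hr.1 2)).2
      have a2 := (hU (T + 1) (by omega) (r 0) (hr.1 0)).1
      rw [show T + 1 + 2 = T + 3 from rfl] at a1 a2
      linarith

/-- The supremum `maxcon x` is attained: there are an even initial
configuration and a run-time `T` whose contribution at `x` equals `maxcon x`. -/
theorem maxcon_attained (next : Vtx → Vtx) (hnext : IsRotorSequence next)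
    (x : Vtx) (hx : inV x) :
    ∃ (f0 : Vtx → ℕ) (arr0 : Vtx → Vtx) (T : ℕ),
      EvenConfig f0 ∧ (∀ y : Vtx, arr0 y ∈ DIRset) ∧
      con next f0 arr0 x T = maxcon next x := by
  obtain ⟨e, he, U, hU⟩ := good_rotor hnext x
  set B : Set ℝ := {c | ∃ r T, T ≤ U + 3 ∧ Valid x r ∧ c = rval next x r T} with hB
  have hfin : B.Finite := by
    have : (⋃ T ∈ Finset.range (U + 4), Set.range (fun g : Fin (U + 4) → DIRset =>
        rval next x (fun t => if h : t < U + 4 then (g ⟨t, h⟩ : Vtx) else e) T)).Finite := by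
      apply Set.Finite.biUnion (Finset.finite_toSet _)
      intro T _
      exact Set.finite_range _
    refine this.subset ?_
    rintro c ⟨r, T, hT, hr, rfl⟩
    simp only [Set.mem_iUnion]
    refine ⟨T, Finset.mem_range.2 (by omega), fun i => ⟨r i, hr.1 i⟩, ?_⟩
    unfold rval
    refine Finset.sum_congr rfl fun t ht => ?_
    rw [Finset.mem_range] at ht
    simp only
    rw [dif_pos (by omega), dif_pos (by omega)]
  have hne : B.Nonempty := ⟨_, fun _ => e, 0, by omega, ⟨fun _ => he, fun _ _ => rfl⟩, rfl⟩
  obtain ⟨m, ⟨r, T, hT, hr, rfl⟩, hm⟩ := hfin.exists_maximal hne |>.imp fun m h =>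
    (⟨h.1, fun c hc => (le_total c m).elim id (fun hh => h.2 hc hh)⟩ :
      m ∈ B ∧ ∀ c ∈ B, c ≤ m)
  have hbound : ∀ T' : ℕ, ∀ r', Valid x r' → rval next x r' T' ≤ rval next x r T := by
    intro T'
    induction T' using Nat.strong_induction_on with
    | _ T' ih =>
      intro r' hr'
      rcases Nat.lt_or_ge (U + 3) T' with h | h
      · obtain ⟨S, rfl⟩ : ∃ S, T' = S + 4 := ⟨T' - 4, by omega⟩
        obtain ⟨r'', hr'', hle⟩ := reduce next x e he U hU hr' S (by omega)
        exact hle.trans (ih (S + 2) (by omega) r'' hr'')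
      · exact hm _ ⟨r', T', h, hr', rfl⟩
  obtain ⟨f0, hf, hreal⟩ := realize hnext hx hr T
  have hcon : con next f0 (fun _ => r 0) x T = rval next x r T := by
    rw [con_eq hnext f0 (fun _ => hr.1 0)]
    unfold rval
    refine Finset.sum_congr rfl fun t ht => ?_
    rw [Finset.mem_range] at ht
    simp only
    rw [hreal t (by omega), hreal (t + 1) (by omega)]
  refine ⟨f0, fun _ => r 0, T, hf, fun _ => hr.1 0, ?_⟩
  unfold maxcon
  symm
  apply IsGreatest.csSup_eq
  constructor
  · exact ⟨f0, fun _ => r 0, T, hf, fun _ => hr.1 0, rfl⟩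
  · rintro c ⟨f1, arr1, T1, hf1, ha1, rfl⟩
    rw [hcon, con_eq hnext f1 ha1]
    exact hbound T1 _ (valid_propp hnext hf1 ha1 x)
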